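/- Suppose q = -1 in k, and let M = H_n(-1) ⊗_{H_λ} k and N = H_n(-1) ⊗_{H_μ} k be modules induced from the (unique) 1-dimensional representations of two parabolic subalgebras, with canonical generators c and c'. For a module homomorphism φ : N → M, the following are equivalent: (a) φ factors through a free H_n(-1)-module; (b) φ(c') ∈ x_μ M where x_μ = Σ_{σ ∈ S_μ} T_σ; (c) φ(c') ∈ (T_i + 1)M for each i with τ_i ∈ B_μ. -/

import Mathlib

noncomputable section
open Classical

variable (k : Type) [Field k] (N : ℕ)

/-- The basic transposition `τ_i = (i, i+1)` in `S_{N+1}`. -/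
def tau (i : Fin N) : Equiv.Perm (Fin (N + 1)) := Equiv.swap i.castSucc i.succ

/-- The Coxeter length of a permutation. -/
def len (σ : Equiv.Perm (Fin (N + 1))) : ℕ :=
  sInf {m | ∃ l : List (Fin N), l.length = m ∧ (l.map (tau N)).prod = σ}

/-- The Young subgroup `S_λ` generated by the basic transpositions indexed by `B`. -/
def youngSubgroup (B : Set (Fin N)) : Subgroup (Equiv.Perm (Fin (N + 1))) :=
  Subgroup.closure (tau N '' B)

/-- `σ` is a distinguished (minimal length) left coset representative of `σ S_λ`. -/
def IsDistL (B : Set (Fin N)) (σ : Equiv.Perm (Fin (N + 1))) : Prop :=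
  ∀ s ∈ youngSubgroup N B, len N σ ≤ len N (σ * s)

/-- The set `D_λ` of distinguished left coset representatives. -/
def Dset (B : Set (Fin N)) : Type := {σ : Equiv.Perm (Fin (N + 1)) // IsDistL N B σ}

/-- `χ : Fin N → k` restricted to `B` defines a one-dimensional representation of
the parabolic subalgebra `H_λ`: the values satisfy the quadratic relation and are
compatible with the braid relations. -/
def IsOneDimRep (q : k) (B : Set (Fin N)) (χ : Fin N → k) : Prop :=
  (∀ i ∈ B, (χ i - q) * (χ i + 1) = 0) ∧
  (∀ i ∈ B, ∀ j ∈ B, ((i : ℕ) + 1 = j ∨ (j : ℕ) + 1 = i) →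
    χ i * χ j * χ i = χ j * χ i * χ j)

/-- The underlying vector space of the induced module `H_n(q) ⊗_{H_λ} k(χ)`,
with standard basis `{T_σ c : σ ∈ D_λ}` indexed by distinguished coset
representatives. -/
def IndM (B : Set (Fin N)) : Type := Dset N B →₀ k

instance (B : Set (Fin N)) : AddCommGroup (IndM k N B) :=
  inferInstanceAs (AddCommGroup (Dset N B →₀ k))

instance (B : Set (Fin N)) : Module k (IndM k N B) :=
  inferInstanceAs (Module k (Dset N B →₀ k))

/-- The action of the generator `T_i` on the standard basis vector `v_σ` of the
induced module `H_n(q) ⊗_{H_λ} k(χ)`: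
`T_i v_σ = v_{τ_iσ}` if `σ ∈ A_i(λ)`;
`T_i v_σ = (q-1) v_σ + q v_{τ_iσ}` if `τ_i σ ∈ A_i(λ)`, `τ_iσ < σ`;
`T_i v_σ = χ_σ(T_i) v_σ = χ(T_j) v_σ` with `τ_j = σ⁻¹τ_iσ ∈ B_λ` if `σ ∈ B_i(λ)`. -/
def indAct (q : k) (B : Set (Fin N)) (χ : Fin N → k) (i : Fin N) (σ : Dset N B) :
    IndM k N B :=
  if h : ∃ j, j ∈ B ∧ σ.1⁻¹ * tau N i * σ.1 = tau N j then
    χ h.choose • Finsupp.single σ 1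
  else if hD : IsDistL N B (tau N i * σ.1) then
    (if len N σ.1 < len N (tau N i * σ.1) then
      Finsupp.single ⟨tau N i * σ.1, hD⟩ 1
    else
      (q - 1) • Finsupp.single σ 1 + q • Finsupp.single ⟨tau N i * σ.1, hD⟩ 1)
  else 0

/-- The operator by which the generator `T_i` acts on the induced module
`H_n(q) ⊗_{H_λ} k(χ)`. -/
def indT (q : k) (B : Set (Fin N)) (χ : Fin N → k) (i : Fin N) :
    Module.End k (IndM k N B) :=
  (Finsupp.lift (IndM k N B) k (Dset N B)) (indAct k N q B χ i)


/-- The standard basis element `T_σ` of a Hecke-module action: the product of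
the operators `T_i` along a reduced word for `σ` (junk `0` if no word exists,
which never happens). -/
def Tperm {M : Type} [AddCommGroup M] [Module k M]
    (T : Fin N → Module.End k M) (σ : Equiv.Perm (Fin (N + 1))) : Module.End k M :=
  if h : ∃ l : List (Fin N), (l.map (tau N)).prod = σ ∧ l.length = len N σ then
    ((h.choose.map T).prod) else 0

/-- The identity permutation as a distinguished coset representative: the
canonical generator `c` of an induced module. -/
def oneDist (B : Set (Fin N)) : Dset N B :=
  ⟨1, fun s _ => by
    have h : len N (1 : Equiv.Perm (Fin (N + 1))) = 0 :=
      Nat.sInf_eq_zero.mpr (Or.inl ⟨[], rfl, rfl⟩)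
    exact h ▸ Nat.zero_le _⟩

section helpers


lemma pinv1 (w : Equiv.Perm (Fin (N+1))) (x) : w (w⁻¹ x) = x := by simp
lemma pinv2 (w : Equiv.Perm (Fin (N+1))) (x) : w⁻¹ (w x) = x := by simp

lemma tau_val (i : Fin N) (x : Fin (N+1)) : (tau N i x : ℕ) =
    if (x:ℕ) = i then (i:ℕ)+1 else if (x:ℕ) = i + 1 then (i:ℕ) else x := by
  unfold tau
  rw [Equiv.swap_apply_def]
  simp only [Fin.ext_iff, Fin.val_castSucc, Fin.val_succ]
  split_ifs <;> simp

lemma tau_tau (i : Fin N) (x : Fin (N+1)) : tau N i (tau N i x) = x := by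
  simp [tau]

lemma tau_mul_self (i : Fin N) : tau N i * tau N i = 1 := by
  simp [tau]

lemma tau_inv (i : Fin N) : (tau N i)⁻¹ = tau N i := by
  simp [tau]

lemma tau_mul_cancel (i : Fin N) (w : Equiv.Perm (Fin (N+1))) :
    tau N i * (tau N i * w) = w := by
  rw [← mul_assoc, tau_mul_self, one_mul]

lemma mul_tau_cancel (i : Fin N) (w : Equiv.Perm (Fin (N+1))) :
    (w * tau N i) * tau N i = w := by
  rw [mul_assoc, tau_mul_self, mul_one]

lemma tau_castSucc (i : Fin N) : tau N i i.castSucc = i.succ := by simp [tau]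
lemma tau_succ (i : Fin N) : tau N i i.succ = i.castSucc := by simp [tau]

/-- order is kept by `τ_i` except on the pair `(i,i+1)` -/
lemma tau_lt (i : Fin N) {x y : Fin (N+1)} (h : x < y)
    (h' : ¬ (x = i.castSucc ∧ y = i.succ)) : tau N i x < tau N i y := by
  rw [Fin.lt_def, tau_val, tau_val]
  simp only [Fin.ext_iff, Fin.val_castSucc, Fin.val_succ] at h'
  rw [Fin.lt_def] at h
  split_ifs <;> omega

/-- inversions -/
def invs (w : Equiv.Perm (Fin (N+1))) : Finset (Fin (N+1) × Fin (N+1)) :=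
  Finset.univ.filter fun p => p.1 < p.2 ∧ w p.2 < w p.1

lemma mem_invs (w : Equiv.Perm (Fin (N+1))) (a b : Fin (N+1)) :
    (a, b) ∈ invs N w ↔ a < b ∧ w b < w a := by
  simp [invs]

lemma invs_mul_tau (w : Equiv.Perm (Fin (N+1))) (i : Fin N) (h : w i.castSucc < w i.succ) :
    (invs N (w * tau N i)).card = (invs N w).card + 1 := by
  have hlt : i.castSucc < i.succ := Fin.castSucc_lt_succ
  have e : invs N (w * tau N i) = insert (i.castSucc, i.succ)
      ((invs N w).map ((tau N i).prodCongr (tau N i)).toEmbedding) := by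
    ext ⟨a, b⟩
    simp only [Finset.mem_insert, mem_invs, Finset.mem_map, Equiv.Perm.mul_apply, Prod.mk.injEq, Prod.exists,
      Equiv.coe_toEmbedding, Equiv.prodCongr_apply, Prod.map_apply]
    constructor
    · rintro ⟨h1, h2⟩
      by_cases hc : a = i.castSucc ∧ b = i.succ
      · exact Or.inl hc
      · exact Or.inr ⟨tau N i a, tau N i b, ⟨tau_lt N i h1 hc, h2⟩, tau_tau N i a, tau_tau N i b⟩
    · rintro (⟨rfl, rfl⟩ | ⟨a', b', ⟨h1, h2⟩, rfl, rfl⟩)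
      · exact ⟨hlt, by rw [tau_castSucc, tau_succ]; exact h⟩
      · refine ⟨tau_lt N i h1 ?_, by rw [tau_tau, tau_tau]; exact h2⟩
        rintro ⟨rfl, rfl⟩
        exact absurd h2 (not_lt.mpr h.le)
  rw [e, Finset.card_insert_of_notMem, Finset.card_map]
  simp only [mem_invs, Finset.mem_map, Prod.mk.injEq, Prod.exists,
      Equiv.coe_toEmbedding, Equiv.prodCongr_apply, Prod.map_apply]
  rintro ⟨a', b', ⟨h1, h2⟩, h3, h4⟩
  have h5 := tau_tau N i a'
  have h6 := tau_tau N i b'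
  rw [h3, tau_castSucc] at h5
  rw [h4, tau_succ] at h6
  rw [← h5, ← h6] at h1
  exact absurd h1 (not_lt.mpr hlt.le)

lemma asc_or_desc (w : Equiv.Perm (Fin (N+1))) (i : Fin N) :
    w i.castSucc < w i.succ ∨ w i.succ < w i.castSucc := by
  apply lt_or_gt_of_ne
  intro h
  exact absurd (w.injective h) (Fin.castSucc_lt_succ).ne

lemma mul_tau_asc (w : Equiv.Perm (Fin (N+1))) (i : Fin N) (h : w i.succ < w i.castSucc) :
    (w * tau N i) i.castSucc < (w * tau N i) i.succ := by
  simpa [Equiv.Perm.mul_apply, tau_castSucc, tau_succ] using h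

lemma invs_mul_tau' (w : Equiv.Perm (Fin (N+1))) (i : Fin N) (h : w i.succ < w i.castSucc) :
    (invs N (w * tau N i)).card + 1 = (invs N w).card := by
  have := invs_mul_tau N (w * tau N i) i (mul_tau_asc N w i h)
  rw [mul_tau_cancel] at this
  exact this.symm

lemma eq_one_of_asc (w : Equiv.Perm (Fin (N+1))) (h : ∀ i : Fin N, w i.castSucc < w i.succ) :
    w = 1 := by
  have hm : StrictMono w := Fin.strictMono_iff_lt_succ.mpr h
  have := Subsingleton.elim (hm.orderIsoOfSurjective _ w.surjective) (OrderIso.refl _)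
  ext x
  have := congrArg (fun f => (f x : Fin (N+1))) this
  simpa [Fin.ext_iff] using this

lemma exists_word (n : ℕ) : ∀ w : Equiv.Perm (Fin (N+1)), (invs N w).card = n →
    ∃ l : List (Fin N), l.length = n ∧ (l.map (tau N)).prod = w := by
  induction n with
  | zero =>
    intro w hw
    refine ⟨[], rfl, ?_⟩
    rw [eq_one_of_asc N w]; · rfl
    intro i
    rcases asc_or_desc N w i with h | h
    · exact h
    · have := invs_mul_tau' N w i h
      omega
  | succ n ih =>
    intro w hw
    by_cases hw1 : ∀ i : Fin N, w i.castSucc < w i.succ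
    · have := eq_one_of_asc N w hw1
      subst this
      exfalso
      have : invs N 1 = ∅ := by
        apply Finset.filter_false_of_mem
        rintro ⟨a, b⟩ _ ⟨h1, h2⟩
        exact absurd h1 (not_lt.mpr (le_of_lt h2))
      rw [this] at hw
      simp at hw
    · push Not at hw1
      obtain ⟨i, hi⟩ := hw1
      have hi' : w i.succ < w i.castSucc := by
        rcases asc_or_desc N w i with h | h
        · exact absurd h (not_lt.mpr hi)
        · exact h
      have h2 := invs_mul_tau' N w i hi'
      obtain ⟨l, hl, hp⟩ := ih (w * tau N i) (by omega)
      refine ⟨l ++ [i], by simp [hl], ?_⟩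
      simp [hp, mul_tau_cancel]

lemma invs_le (l : List (Fin N)) : (invs N (l.map (tau N)).prod).card ≤ l.length := by
  induction l using List.reverseRecOn with
  | nil =>
    have : invs N 1 = ∅ := by
      apply Finset.filter_false_of_mem
      rintro ⟨a, b⟩ _ ⟨h1, h2⟩
      exact absurd h1 (not_lt.mpr (le_of_lt h2))
    simp [this]
  | append_singleton l i ih =>
    simp only [List.map_append, List.prod_append, List.map_cons, List.map_nil, List.prod_cons,
      List.prod_nil, mul_one, List.length_append, List.length_cons, List.length_nil]
    rcases asc_or_desc N (l.map (tau N)).prod i with h | h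
    · rw [invs_mul_tau N _ i h]; omega
    · have := invs_mul_tau' N _ i h
      omega

lemma len_eq (w : Equiv.Perm (Fin (N+1))) : len N w = (invs N w).card := by
  apply le_antisymm
  · exact Nat.sInf_le (exists_word N _ w rfl)
  · obtain ⟨l, hl, hp⟩ := Nat.sInf_mem
      (s := {m | ∃ l : List (Fin N), l.length = m ∧ (l.map (tau N)).prod = w})
      ⟨_, exists_word N _ w rfl⟩
    unfold len
    rw [← hl, ← hp]
    exact invs_le N l

lemma len_inv_le (w : Equiv.Perm (Fin (N+1))) : len N w⁻¹ ≤ len N w := by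
  obtain ⟨l, hl, hp⟩ := exists_word N _ w rfl
  rw [← len_eq] at hl
  refine Nat.sInf_le ⟨l.reverse, by simpa using hl, ?_⟩
  rw [← hp, List.prod_inv_reverse, List.map_reverse, List.map_map]
  congr 2

lemma len_inv (w : Equiv.Perm (Fin (N+1))) : len N w⁻¹ = len N w :=
  le_antisymm (len_inv_le N w) (by simpa using len_inv_le N w⁻¹)

lemma len_mul_tau_asc (w : Equiv.Perm (Fin (N+1))) (i : Fin N) (h : w i.castSucc < w i.succ) :
    len N (w * tau N i) = len N w + 1 := by
  rw [len_eq, len_eq, invs_mul_tau N w i h]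

lemma len_mul_tau_desc (w : Equiv.Perm (Fin (N+1))) (i : Fin N) (h : w i.succ < w i.castSucc) :
    len N (w * tau N i) + 1 = len N w := by
  rw [len_eq, len_eq, invs_mul_tau' N w i h]

lemma len_tau_mul_asc (w : Equiv.Perm (Fin (N+1))) (i : Fin N)
    (h : w⁻¹ i.castSucc < w⁻¹ i.succ) :
    len N (tau N i * w) = len N w + 1 := by
  rw [← len_inv, ← len_inv N w, mul_inv_rev, tau_inv, len_mul_tau_asc N _ i h]

lemma len_tau_mul_desc (w : Equiv.Perm (Fin (N+1))) (i : Fin N)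
    (h : w⁻¹ i.succ < w⁻¹ i.castSucc) :
    len N (tau N i * w) + 1 = len N w := by
  rw [← len_inv, ← len_inv N w, mul_inv_rev, tau_inv, len_mul_tau_desc N _ i h]

lemma len_lt_iff (w : Equiv.Perm (Fin (N+1))) (i : Fin N) :
    len N w < len N (tau N i * w) ↔ w⁻¹ i.castSucc < w⁻¹ i.succ := by
  rcases asc_or_desc N w⁻¹ i with h | h
  · have := len_tau_mul_asc N w i h
    simp only [h, iff_true]; omega
  · have := len_tau_mul_desc N w i h
    simp only [not_lt.mpr h.le, iff_false]; omega

/-- same block -/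
def SB (B : Set (Fin N)) (a b : Fin (N+1)) : Prop :=
  ∀ i : Fin N, i ∉ B → (a ≤ i.castSucc ↔ b ≤ i.castSucc)

lemma SB_young (B : Set (Fin N)) {s : Equiv.Perm (Fin (N+1))} (hs : s ∈ youngSubgroup N B) :
    ∀ x, SB N B x (s x) := by
  induction hs using Subgroup.closure_induction with
  | mem y hy =>
    obtain ⟨j, hj, rfl⟩ := hy
    intro x i hi
    have : (i:ℕ) ≠ j := fun h => hi (by rwa [Fin.ext h])
    rw [Fin.le_def, Fin.le_def, tau_val]
    simp only [Fin.val_castSucc]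
    split_ifs <;> omega
  | one => intro x i _; rfl
  | mul a b _ _ ha hb =>
    intro x i hi
    exact (hb x i hi).trans (ha (b x) i hi)
  | inv a _ ha =>
    intro x i hi
    have := ha (a⁻¹ x) i hi
    simpa using this.symm

lemma lt_of_SB (B : Set (Fin N)) (f : Equiv.Perm (Fin (N+1)))
    (hf : ∀ j ∈ B, f j.castSucc < f j.succ) {a b : Fin (N+1)} (hab : a < b)
    (h : SB N B a b) : f a < f b := by
  have key : ∀ n : ℕ, ∀ c : Fin (N+1), (c:ℕ) = a + 1 + n → c ≤ b → f a < f c := by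
    intro n
    induction n with
    | zero =>
      intro c hc hcb
      rw [Fin.le_def] at hcb
      have hj : (a:ℕ) < N := by omega
      have e1 : a = (⟨a, hj⟩ : Fin N).castSucc := by ext; simp
      have e2 : c = (⟨a, hj⟩ : Fin N).succ := by ext; simp [hc]
      have hB : (⟨a, hj⟩ : Fin N) ∈ B := by
        by_contra hn
        have := (h _ hn).1 (by simp)
        simp only [Fin.le_def, Fin.val_castSucc] at this
        omega
      rw [e2]; conv_lhs => rw [e1]
      exact hf _ hB
    | succ n ih =>
      intro c hc hcb
      rw [Fin.le_def] at hcb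
      have hj : (a:ℕ) + 1 + n < N := by omega
      have e2 : c = (⟨a + 1 + n, hj⟩ : Fin N).succ := by ext; simp [hc]; omega
      have hB : (⟨a + 1 + n, hj⟩ : Fin N) ∈ B := by
        by_contra hn
        have := (h _ hn).1 (by simp only [Fin.le_def, Fin.val_castSucc]; omega)
        simp only [Fin.le_def, Fin.val_castSucc] at this
        omega
      refine (ih (⟨a + 1 + n, hj⟩ : Fin N).castSucc (by simp) ?_).trans ?_
      · simp only [Fin.le_def, Fin.val_castSucc]; omega
      · rw [e2]; exact hf _ hB
  rw [Fin.lt_def] at hab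
  exact key (b - a - 1) b (by omega) le_rfl

lemma lt_of_not_SB (B : Set (Fin N)) {s : Equiv.Perm (Fin (N+1))} (hs : s ∈ youngSubgroup N B)
    {a b : Fin (N+1)} (hab : a < b) (h : ¬ SB N B a b) : s a < s b := by
  unfold SB at h
  push Not at h
  obtain ⟨i, hi, h⟩ := h
  have h1 := SB_young N B hs a i hi
  have h2 := SB_young N B hs b i hi
  rw [Fin.lt_def] at hab ⊢
  simp only [Fin.le_def, Fin.lt_def, Fin.val_castSucc] at *
  omega

lemma SB_symm (B : Set (Fin N)) {a b} (h : SB N B a b) : SB N B b a :=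
  fun i hi => (h i hi).symm

lemma SB_trans (B : Set (Fin N)) {a b c} (h : SB N B a b) (h' : SB N B b c) : SB N B a c :=
  fun i hi => (h i hi).trans (h' i hi)

lemma SB_self (B : Set (Fin N)) {i : Fin N} (hi : i ∈ B) : SB N B i.castSucc i.succ := by
  intro j hj
  have : (i:ℕ) ≠ j := fun h => hj (by rwa [← Fin.ext h])
  simp only [Fin.le_def, Fin.val_castSucc, Fin.val_succ]
  omega

lemma tau_mem (B : Set (Fin N)) {i : Fin N} (hi : i ∈ B) : tau N i ∈ youngSubgroup N B :=
  Subgroup.subset_closure ⟨i, hi, rfl⟩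

lemma asc_of_dist (B : Set (Fin N)) {σ : Equiv.Perm (Fin (N+1))} (h : IsDistL N B σ) :
    ∀ j ∈ B, σ j.castSucc < σ j.succ := by
  intro j hj
  rcases asc_or_desc N σ j with h1 | h1
  · exact h1
  · have := len_mul_tau_desc N σ j h1
    have := h _ (tau_mem N B hj)
    omega

lemma exists_dist (B : Set (Fin N)) (w : Equiv.Perm (Fin (N+1))) :
    ∃ s ∈ youngSubgroup N B, IsDistL N B (w * s) := by
  obtain ⟨s, hs, hmin⟩ := Set.exists_min_image
    ((youngSubgroup N B : Subgroup _) : Set (Equiv.Perm (Fin (N+1))))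
    (fun s => len N (w * s)) (Set.toFinite _) ⟨1, one_mem _⟩
  refine ⟨s, hs, fun t ht => ?_⟩
  rw [mul_assoc]
  exact hmin _ (mul_mem hs ht)

lemma asc_unique (B : Set (Fin N)) {σ s : Equiv.Perm (Fin (N+1))} (hs : s ∈ youngSubgroup N B)
    (h : ∀ j ∈ B, σ j.castSucc < σ j.succ)
    (h' : ∀ j ∈ B, (σ * s) j.castSucc < (σ * s) j.succ) : s = 1 := by
  apply eq_one_of_asc
  intro i
  by_cases hi : i ∈ B
  · rcases asc_or_desc N s i with h1 | h1
    · exact h1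
    · exfalso
      have h2 : SB N B (s i.succ) (s i.castSucc) :=
        SB_trans N B (SB_symm N B (SB_young N B hs _))
          (SB_trans N B (SB_symm N B (SB_self N B hi)) (SB_young N B hs _))
      have h3 := lt_of_SB N B σ h h1 h2
      exact absurd h3 (not_lt.mpr (h' i hi).le)
  · have h1 := (SB_young N B hs i.castSucc i hi).1 le_rfl
    have h2 := (SB_young N B hs i.succ i hi).not.1 (not_le.mpr Fin.castSucc_lt_succ)
    exact lt_of_le_of_lt h1 (not_le.mp h2)

lemma dist_iff (B : Set (Fin N)) (σ : Equiv.Perm (Fin (N+1))) :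
    IsDistL N B σ ↔ ∀ j ∈ B, σ j.castSucc < σ j.succ := by
  refine ⟨asc_of_dist N B, fun h => ?_⟩
  obtain ⟨s, hs, hd⟩ := exists_dist N B σ
  have := asc_unique N B hs h (asc_of_dist N B hd)
  subst this
  simpa using hd

/-- underlying permutation -/
def Dset.dv {N : ℕ} {B : Set (Fin N)} (σ : Dset N B) : Equiv.Perm (Fin (N+1)) := σ.1

/-- constructor -/
def Dset.mkD {N : ℕ} {B : Set (Fin N)} (w : Equiv.Perm (Fin (N+1))) (h : IsDistL N B w) :
    Dset N B := ⟨w, h⟩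

lemma Dset.dd {N : ℕ} {B : Set (Fin N)} (σ : Dset N B) : IsDistL N B σ.dv := σ.2

@[simp] lemma Dset.dv_mkD {N : ℕ} {B : Set (Fin N)} (w : Equiv.Perm (Fin (N+1)))
    (h : IsDistL N B w) : (Dset.mkD w h).dv = w := rfl

lemma Dset.dext {N : ℕ} {B : Set (Fin N)} {σ σ' : Dset N B} (h : σ.dv = σ'.dv) : σ = σ' :=
  Subtype.ext h

@[simp] lemma Dset.dv_one (B : Set (Fin N)) : (oneDist N B).dv = 1 := rfl

/-- the distinguished representative of a coset -/
def rep (B : Set (Fin N)) (w : Equiv.Perm (Fin (N+1))) : Dset N B :=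
  Dset.mkD (w * (exists_dist N B w).choose) (exists_dist N B w).choose_spec.2

lemma rep_mem (B : Set (Fin N)) (w : Equiv.Perm (Fin (N+1))) :
    w⁻¹ * (rep N B w).dv ∈ youngSubgroup N B := by
  simpa [rep] using (exists_dist N B w).choose_spec.1

lemma rep_eq (B : Set (Fin N)) {w : Equiv.Perm (Fin (N+1))} {σ : Dset N B}
    (h : w⁻¹ * σ.dv ∈ youngSubgroup N B) : rep N B w = σ := by
  have h1 : (σ.dv)⁻¹ * (rep N B w).dv ∈ youngSubgroup N B := by
    have := mul_mem (inv_mem h) (rep_mem N B w)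
    simpa [mul_assoc] using this
  have h2 := asc_unique N B h1 (asc_of_dist N B σ.dd)
    (by simpa using asc_of_dist N B (rep N B w).dd)
  exact Dset.dext (inv_mul_eq_one.mp h2).symm

lemma rep_self (B : Set (Fin N)) (σ : Dset N B) : rep N B σ.dv = σ :=
  rep_eq N B (by simp [one_mem])

lemma not_dist (B : Set (Fin N)) {σ : Equiv.Perm (Fin (N+1))} (h : IsDistL N B σ) {i : Fin N}
    (h' : ¬ IsDistL N B (tau N i * σ)) :
    ∃ j ∈ B, σ j.castSucc = i.castSucc ∧ σ j.succ = i.succ := by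
  rw [dist_iff] at h h'
  push Not at h'
  obtain ⟨j, hj, h1⟩ := h'
  refine ⟨j, hj, ?_⟩
  by_contra hc
  exact absurd (tau_lt N i (h j hj) hc) (not_lt.mpr h1)

lemma tau_mul_eq {σ : Equiv.Perm (Fin (N+1))} {i j : Fin N}
    (h : σ j.castSucc = i.castSucc) (h' : σ j.succ = i.succ) :
    tau N i * σ = σ * tau N j := by
  unfold tau
  rw [Equiv.mul_swap_eq_swap_mul, h, h']

lemma not_dist_mul (B : Set (Fin N)) {σ : Equiv.Perm (Fin (N+1))} (h : IsDistL N B σ) {j : Fin N}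
    (hj : j ∈ B) : ¬ IsDistL N B (σ * tau N j) := by
  rw [dist_iff] at h ⊢
  intro h1
  have h2 := h1 j hj
  simp only [Equiv.Perm.mul_apply, tau_castSucc, tau_succ] at h2
  exact absurd h2 (not_lt.mpr (h j hj).le)

lemma dist_of_desc (B : Set (Fin N)) {σ : Equiv.Perm (Fin (N+1))} (h : IsDistL N B σ) {i : Fin N}
    (h' : σ⁻¹ i.succ < σ⁻¹ i.castSucc) : IsDistL N B (tau N i * σ) := by
  by_contra hc
  obtain ⟨j, hj, h1, h2⟩ := not_dist N B h hc
  rw [← h1, ← h2] at h'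
  simp only [pinv2] at h'
  exact absurd h' (not_lt.mpr Fin.castSucc_lt_succ.le)

/-- left ascents agree along a coset -/
lemma asc_coset (B : Set (Fin N)) {σ w : Equiv.Perm (Fin (N+1))} (h : IsDistL N B σ) {i : Fin N}
    (h' : IsDistL N B (tau N i * σ)) (hw : w⁻¹ * σ ∈ youngSubgroup N B) :
    (w⁻¹ i.castSucc < w⁻¹ i.succ ↔ σ⁻¹ i.castSucc < σ⁻¹ i.succ) := by
  have key : ¬ SB N B (σ⁻¹ i.castSucc) (σ⁻¹ i.succ) := by
    intro hS
    rcases asc_or_desc N σ⁻¹ i with h1 | h1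
    · have := lt_of_SB N B _ (asc_of_dist N B h') h1 hS
      simp only [Equiv.Perm.mul_apply, pinv1, tau_castSucc, tau_succ] at this
      exact absurd this (not_lt.mpr Fin.castSucc_lt_succ.le)
    · have := lt_of_SB N B _ (asc_of_dist N B h) h1 (SB_symm N B hS)
      simp only [pinv1] at this
      exact absurd this (not_lt.mpr Fin.castSucc_lt_succ.le)
  have e : ∀ x, w⁻¹ x = (w⁻¹ * σ) (σ⁻¹ x) := by intro x; simp
  rw [e, e]
  rcases asc_or_desc N σ⁻¹ i with h1 | h1
  · simp only [h1, iff_true]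
    exact lt_of_not_SB N B hw h1 key
  · simp only [not_lt.mpr h1.le, iff_false, not_lt]
    exact (lt_of_not_SB N B hw h1 (fun h => key (SB_symm N B h))).le

lemma left_asc_tau (w : Equiv.Perm (Fin (N+1))) (i : Fin N) :
    ((tau N i * w)⁻¹ i.castSucc < (tau N i * w)⁻¹ i.succ ↔ ¬ (w⁻¹ i.castSucc < w⁻¹ i.succ)) := by
  rw [mul_inv_rev, tau_inv, Equiv.Perm.mul_apply, Equiv.Perm.mul_apply, tau_castSucc, tau_succ]
  rcases asc_or_desc N w⁻¹ i with h | h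
  · simp only [h, not_lt.mpr h.le, not_true]
  · simp only [h, not_lt.mpr h.le, not_false_iff]


/-- basis vector -/
def bv (B : Set (Fin N)) (σ : Dset N B) : IndM k N B := Finsupp.single σ (1:k)

/-- coefficient -/
def cf (B : Set (Fin N)) (σ : Dset N B) : IndM k N B →ₗ[k] k :=
  (Finsupp.lapply σ : (Dset N B →₀ k) →ₗ[k] k)

lemma cf_bv (B : Set (Fin N)) (σ σ' : Dset N B) :
    cf k N B σ (bv k N B σ') = if σ' = σ then 1 else 0 := by
  change (Finsupp.single σ' (1:k)) σ = _
  rw [Finsupp.single_apply]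

lemma cf_ext (B : Set (Fin N)) {m m' : IndM k N B} (h : ∀ σ, cf k N B σ m = cf k N B σ m') :
    m = m' := Finsupp.ext (fun σ => h σ)

instance dset_finite (B : Set (Fin N)) : Finite (Dset N B) :=
  inferInstanceAs (Finite {σ : Equiv.Perm (Fin (N + 1)) // IsDistL N B σ})

/-- the vector with given coefficients -/
def ofC (B : Set (Fin N)) (f : Dset N B → k) : IndM k N B := Finsupp.equivFunOnFinite.symm f

lemma cf_ofC (B : Set (Fin N)) (f : Dset N B → k) (σ : Dset N B) :
    cf k N B σ (ofC k N B f) = f σ := rfl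

lemma lin_ext (B : Set (Fin N)) {P : Type*} [AddCommGroup P] [Module k P]
    {f g : IndM k N B →ₗ[k] P} (h : ∀ σ, f (bv k N B σ) = g (bv k N B σ)) : f = g := by
  refine Finsupp.lhom_ext' (M := k) (α := Dset N B) (φ := f) (ψ := g) ?_
  intro σ
  apply LinearMap.ext_ring
  exact h σ

/-- The operator at `q=-1`. -/
abbrev TT (B : Set (Fin N)) (i : Fin N) : Module.End k (IndM k N B) :=
  indT k N (-1) B (fun _ => -1) i

lemma TT_bv (B : Set (Fin N)) (i : Fin N) (σ : Dset N B) :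
    TT k N B i (bv k N B σ) = if hD : IsDistL N B (tau N i * σ.dv) then
      (if (σ.dv)⁻¹ i.castSucc < (σ.dv)⁻¹ i.succ then bv k N B (Dset.mkD (_) (hD))
       else (-2 : k) • bv k N B σ - bv k N B (Dset.mkD (_) (hD))) else - bv k N B σ := by
  have e : TT k N B i (bv k N B σ) = indAct k N (-1) B (fun _ => -1) i σ := by
    change (Finsupp.lift (IndM k N B) k (Dset N B)) (indAct k N (-1) B (fun _ => -1) i)
      (Finsupp.single σ 1) = _
    rw [Finsupp.lift_apply, Finsupp.sum_single_index] <;> simp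
  rw [e]
  change (if h : ∃ j, j ∈ B ∧ σ.dv⁻¹ * tau N i * σ.dv = tau N j then
      (-1 : k) • bv k N B σ
    else if hD : IsDistL N B (tau N i * σ.dv) then
      (if len N σ.dv < len N (tau N i * σ.dv) then bv k N B (Dset.mkD _ hD)
      else ((-1 : k) - 1) • bv k N B σ + (-1 : k) • bv k N B (Dset.mkD _ hD))
    else 0) = _
  by_cases hD : IsDistL N B (tau N i * σ.dv)
  · have h1 : ¬ ∃ j, j ∈ B ∧ σ.dv⁻¹ * tau N i * σ.dv = tau N j := by
      rintro ⟨j, hj, h⟩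
      apply not_dist_mul N B σ.dd hj
      rw [← h]
      simpa [mul_assoc] using hD
    rw [dif_neg h1, dif_pos hD, dif_pos hD]
    by_cases ha : (σ.dv)⁻¹ i.castSucc < (σ.dv)⁻¹ i.succ
    · rw [if_pos ha, if_pos ((len_lt_iff N _ _).2 ha)]
    · rw [if_neg ha, if_neg (fun h => ha ((len_lt_iff N _ _).1 h))]
      rw [neg_one_smul, ← sub_eq_add_neg]
      norm_num
  · have h1 : ∃ j, j ∈ B ∧ σ.dv⁻¹ * tau N i * σ.dv = tau N j := by
      obtain ⟨j, hj, h1, h2⟩ := not_dist N B σ.dd hD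
      refine ⟨j, hj, ?_⟩
      rw [mul_assoc, tau_mul_eq N h1 h2]
      simp
    rw [dif_pos h1, dif_neg hD]
    rw [neg_one_smul]

lemma TT_mk (B : Set (Fin N)) (i : Fin N) (w) (hw : IsDistL N B w) :
    TT k N B i (bv k N B (Dset.mkD w hw)) = if hD : IsDistL N B (tau N i * w) then
      (if w⁻¹ i.castSucc < w⁻¹ i.succ then bv k N B (Dset.mkD _ hD)
       else (-2 : k) • bv k N B (Dset.mkD w hw) - bv k N B (Dset.mkD _ hD))
      else - bv k N B (Dset.mkD w hw) := TT_bv k N B i (Dset.mkD w hw)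

lemma TT_cf (B : Set (Fin N)) (i : Fin N) (m : IndM k N B) (σ : Dset N B) :
    cf k N B σ (TT k N B i m) = if hD : IsDistL N B (tau N i * σ.dv) then
      (if (σ.dv)⁻¹ i.castSucc < (σ.dv)⁻¹ i.succ then - cf k N B (Dset.mkD (_) (hD)) m
       else cf k N B (Dset.mkD (_) (hD)) m - 2 * cf k N B σ m) else - cf k N B σ m := by
  by_cases hD : IsDistL N B (tau N i * σ.dv)
  · rw [dif_pos hD]
    have hne : ((Dset.mkD (_) (hD)) : Dset N B) ≠ σ := by
      intro h
      have := congrArg Dset.dv h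
      have h2 : tau N i = 1 := by simpa using this
      have h3 := tau_castSucc N i
      rw [h2] at h3
      exact absurd h3 Fin.castSucc_lt_succ.ne
    have hD2 : IsDistL N B (tau N i * (tau N i * σ.dv)) := by rw [tau_mul_cancel]; exact σ.dd
    have hs : ((Dset.mkD (tau N i * (tau N i * σ.dv)) (hD2)) : Dset N B) = σ :=
      Dset.dext (tau_mul_cancel N i σ.dv)
    have key : ∀ (f g : IndM k N B →ₗ[k] k) , f = g → f m = g m := by rintro f g rfl; rfl
    split_ifs with ha
    · refine key (cf k N B σ ∘ₗ TT k N B i) (- cf k N B (Dset.mkD (_) (hD))) (lin_ext k N B fun σ' => ?_)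
      simp only [LinearMap.comp_apply, LinearMap.neg_apply]
      by_cases h1 : σ' = σ
      · subst h1
        rw [TT_bv, dif_pos hD, if_pos ha, cf_bv, cf_bv, if_neg hne, if_neg hne.symm, neg_zero]
      by_cases h2 : σ' = (Dset.mkD (_) (hD))
      · subst h2
        rw [TT_mk, dif_pos hD2, if_neg (by rw [left_asc_tau]; simpa using ha)]
        rw [hs]
        simp [cf_bv, hne]
      · have h3 : ∀ h, ((Dset.mkD (tau N i * σ'.dv) (h)) : Dset N B) ≠ σ := by
          intro h h4
          apply h2
          apply Dset.dext
          have h5 := congrArg (fun x => tau N i * x) (congrArg Dset.dv h4)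
          simp only [Dset.dv_mkD, tau_mul_cancel] at h5
          exact h5
        rw [TT_bv]
        split_ifs <;> simp [cf_bv, h1, h2, h3]
    · refine key (cf k N B σ ∘ₗ TT k N B i) (cf k N B (Dset.mkD (_) (hD)) - (2:k) • cf k N B σ)
        (lin_ext k N B fun σ' => ?_)
      simp only [LinearMap.comp_apply, LinearMap.sub_apply, LinearMap.smul_apply]
      by_cases h1 : σ' = σ
      · subst h1
        rw [TT_bv, dif_pos hD, if_neg ha]
        simp [cf_bv, hne, hne.symm]
      by_cases h2 : σ' = (Dset.mkD (_) (hD))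
      · subst h2
        rw [TT_mk, dif_pos hD2, if_pos (by rw [left_asc_tau]; simpa using ha)]
        rw [hs]
        simp [cf_bv, hne]
      · have h3 : ∀ h, ((Dset.mkD (tau N i * σ'.dv) (h)) : Dset N B) ≠ σ := by
          intro h h4
          apply h2
          apply Dset.dext
          have h5 := congrArg (fun x => tau N i * x) (congrArg Dset.dv h4)
          simp only [Dset.dv_mkD, tau_mul_cancel] at h5
          exact h5
        rw [TT_bv]
        split_ifs <;> simp [cf_bv, h1, h2, h3]
  · rw [dif_neg hD]
    have key : ∀ (f g : IndM k N B →ₗ[k] k) , f = g → f m = g m := by rintro f g rfl; rfl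
    refine key (cf k N B σ ∘ₗ TT k N B i) (- cf k N B σ) (lin_ext k N B fun σ' => ?_)
    simp only [LinearMap.comp_apply, LinearMap.neg_apply]
    rw [TT_bv]
    by_cases h1 : σ' = σ
    · subst h1
      rw [dif_neg hD, map_neg]
    · have h3 : ∀ h, ((Dset.mkD (tau N i * σ'.dv) (h)) : Dset N B) ≠ σ := by
        intro h h4
        apply hD
        rw [← congrArg Dset.dv h4]
        rw [Dset.dv_mkD, tau_mul_cancel]; exact σ'.dd
      split_ifs <;> simp [cf_bv, h1, h3]

lemma TT_cf_mk (B : Set (Fin N)) (i : Fin N) (m : IndM k N B) (w) (hw : IsDistL N B w) :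
    cf k N B (Dset.mkD w hw) (TT k N B i m) = if hD : IsDistL N B (tau N i * w) then
      (if w⁻¹ i.castSucc < w⁻¹ i.succ then - cf k N B (Dset.mkD _ hD) m
       else cf k N B (Dset.mkD _ hD) m - 2 * cf k N B (Dset.mkD w hw) m)
      else - cf k N B (Dset.mkD w hw) m := TT_cf k N B i m (Dset.mkD w hw)

/-- generation by the canonical generator -/
lemma gen (B : Set (Fin N)) (S : Submodule k (IndM k N B))
    (h1 : bv k N B (oneDist N B) ∈ S) (hT : ∀ i, ∀ m ∈ S, TT k N B i m ∈ S) : S = ⊤ := by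
  have key : ∀ n : ℕ, ∀ σ : Dset N B, len N σ.dv = n → bv k N B σ ∈ S := by
    intro n
    induction n with
    | zero =>
      intro σ hσ
      have : σ = oneDist N B := by
        apply Dset.dext
        change σ.dv = 1
        apply eq_one_of_asc
        intro i
        rcases asc_or_desc N σ.dv i with h | h
        · exact h
        · have := len_mul_tau_desc N σ.dv i h
          omega
      rw [this]; exact h1
    | succ n ih =>
      intro σ hσ
      have : ∃ i : Fin N, (σ.dv)⁻¹ i.succ < (σ.dv)⁻¹ i.castSucc := by
        by_contra hc
        push Not at hc
        have h2 : (σ.dv)⁻¹ = 1 := by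
          apply eq_one_of_asc
          intro i
          exact (asc_or_desc N (σ.dv)⁻¹ i).resolve_right (not_lt.mpr (hc i))
        rw [inv_eq_one] at h2
        rw [h2] at hσ
        have : len N (1 : Equiv.Perm (Fin (N + 1))) = 0 :=
          Nat.sInf_eq_zero.mpr (Or.inl ⟨[], rfl, rfl⟩)
        omega
      obtain ⟨i, hi⟩ := this
      have hD := dist_of_desc N B σ.dd hi
      have hl := len_tau_mul_desc N σ.dv i hi
      have h3 := hT i _ (ih (Dset.mkD (_) (hD)) (by rw [Dset.dv_mkD]; omega))
      have hD2 : IsDistL N B (tau N i * (tau N i * σ.dv)) := by rw [tau_mul_cancel]; exact σ.dd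
      rw [TT_mk, dif_pos hD2, if_pos (by rw [left_asc_tau]; exact not_lt.mpr hi.le)] at h3
      convert h3 using 2
      exact Dset.dext (tau_mul_cancel N i σ.dv).symm
  have h2 : S.mkQ = 0 := lin_ext k N B fun σ => by
    simpa using key _ σ rfl
  rw [← S.ker_mkQ, h2, LinearMap.ker_zero]

/-- functions on the group -/
abbrev FF := Equiv.Perm (Fin (N+1)) → k

/-- left action -/
def LL (i : Fin N) : Module.End k (FF k N) where
  toFun f w := if w⁻¹ i.castSucc < w⁻¹ i.succ then - f (tau N i * w)
    else f (tau N i * w) - 2 * f w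
  map_add' f g := by
    ext w; simp only [Pi.add_apply]; split_ifs <;> ring
  map_smul' c f := by
    ext w; simp only [Pi.smul_apply, smul_eq_mul, RingHom.id_apply]; split_ifs <;> ring

/-- right action -/
def RR (i : Fin N) : Module.End k (FF k N) where
  toFun f w := if w i.castSucc < w i.succ then - f (w * tau N i)
    else f (w * tau N i) - 2 * f w
  map_add' f g := by
    ext w; simp only [Pi.add_apply]; split_ifs <;> ring
  map_smul' c f := by
    ext w; simp only [Pi.smul_apply, smul_eq_mul, RingHom.id_apply]; split_ifs <;> ring

lemma LL_apply (i : Fin N) (f : FF k N) (w) : LL k N i f w =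
   if w⁻¹ i.castSucc < w⁻¹ i.succ then - f (tau N i * w) else f (tau N i * w) - 2 * f w := rfl

lemma RR_apply (i : Fin N) (f : FF k N) (w) : RR k N i f w =
   if w i.castSucc < w i.succ then - f (w * tau N i) else f (w * tau N i) - 2 * f w := rfl

/-- embedding into functions on the group -/
def GG (B : Set (Fin N)) : IndM k N B →ₗ[k] FF k N :=
  LinearMap.pi fun w => cf k N B (rep N B w)

lemma GG_apply (B : Set (Fin N)) (m : IndM k N B) (w) :
    GG k N B m w = cf k N B (rep N B w) m := rfl

lemma GG_inj (B : Set (Fin N)) : Function.Injective (GG k N B) := by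
  intro m m' h
  apply cf_ext
  intro σ
  have := congrFun h σ.dv
  simpa only [GG_apply, rep_self] using this

lemma GG_TT (B : Set (Fin N)) (i : Fin N) (m : IndM k N B) :
    GG k N B (TT k N B i m) = LL k N i (GG k N B m) := by
  ext w
  rw [GG_apply, LL_apply, TT_cf, GG_apply, GG_apply]
  have hw := rep_mem N B w
  by_cases hD : IsDistL N B (tau N i * (rep N B w).dv)
  · rw [dif_pos hD]
    have h1 : rep N B (tau N i * w) = (Dset.mkD (_) (hD)) := by
      apply rep_eq
      rw [Dset.dv_mkD, mul_inv_rev, tau_inv, mul_assoc, tau_mul_cancel]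
      exact hw
    rw [h1]
    simp only [asc_coset N B (rep N B w).dd hD hw]
  · rw [dif_neg hD]
    have h1 : rep N B (tau N i * w) = rep N B w := by
      apply rep_eq
      obtain ⟨j, hj, h1, h2⟩ := not_dist N B (rep N B w).dd hD
      rw [mul_inv_rev, tau_inv, mul_assoc, tau_mul_eq N h1 h2, ← mul_assoc]
      exact mul_mem hw (tau_mem N B hj)
    rw [h1]
    split_ifs <;> ring

lemma left_asc_mul_tau (w : Equiv.Perm (Fin (N+1))) (i j : Fin N) (h : tau N i * w ≠ w * tau N j) :
    ((w * tau N j)⁻¹ i.castSucc < (w * tau N j)⁻¹ i.succ ↔ w⁻¹ i.castSucc < w⁻¹ i.succ) := by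
  have hne : ∀ x y, w⁻¹ x = j.castSucc → w⁻¹ y = j.succ →
      (x = i.castSucc ∧ y = i.succ) ∨ (y = i.castSucc ∧ x = i.succ) → False := by
    rintro x y hx hy hxy
    apply h
    have hx' : w j.castSucc = x := by rw [← hx, pinv1]
    have hy' : w j.succ = y := by rw [← hy, pinv1]
    rcases hxy with ⟨rfl, rfl⟩ | ⟨rfl, rfl⟩
    · exact tau_mul_eq N hx' hy'
    · unfold tau
      rw [Equiv.mul_swap_eq_swap_mul, hx', hy', Equiv.swap_comm]
  rw [mul_inv_rev, tau_inv, Equiv.Perm.mul_apply, Equiv.Perm.mul_apply]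
  rcases asc_or_desc N w⁻¹ i with h1 | h1
  · simp only [h1, iff_true]
    apply tau_lt N j h1
    rintro ⟨ha, hb⟩
    exact hne _ _ ha hb (Or.inl ⟨rfl, rfl⟩)
  · simp only [not_lt.mpr h1.le, iff_false, not_lt]
    apply le_of_lt
    apply tau_lt N j h1
    rintro ⟨ha, hb⟩
    exact hne _ _ ha hb (Or.inr ⟨rfl, rfl⟩)

lemma right_asc_tau_mul (w : Equiv.Perm (Fin (N+1))) (i j : Fin N) (h : tau N i * w ≠ w * tau N j) :
    ((tau N i * w) j.castSucc < (tau N i * w) j.succ ↔ w j.castSucc < w j.succ) := by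
  have := left_asc_mul_tau N w⁻¹ j i (by
    intro h2
    apply h
    have := congrArg (·⁻¹) h2
    simpa [tau_inv] using this.symm)
  simpa only [mul_inv_rev, inv_inv, tau_inv] using this

lemma asc_eq (w : Equiv.Perm (Fin (N+1))) (i j : Fin N) (h : tau N i * w = w * tau N j) :
    (w⁻¹ i.castSucc < w⁻¹ i.succ ↔ w j.castSucc < w j.succ) := by
  rw [← len_lt_iff, h]
  rcases asc_or_desc N w j with h1 | h1
  · have := len_mul_tau_asc N w j h1
    simp only [h1, iff_true]; omega
  · have := len_mul_tau_desc N w j h1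
    simp only [not_lt.mpr h1.le, iff_false]; omega

lemma LR_comm (i j : Fin N) (f : FF k N) :
    LL k N i (RR k N j f) = RR k N j (LL k N i f) := by
  ext w
  by_cases h : tau N i * w = w * tau N j
  · have h2 : tau N i * (w * tau N j) = (w * tau N j) * tau N j := by
      rw [← h, tau_mul_cancel, h, mul_tau_cancel]
    have e : ∀ (g : FF k N) v, tau N i * v = v * tau N j → LL k N i g v = RR k N j g v := by
      intro g v hv
      rw [LL_apply, RR_apply, hv]
      simp only [asc_eq N v i j hv]
    rw [e _ _ h, RR_apply k N j (RR k N j f) w, RR_apply k N j (LL k N i f) w, e f _ h, e f _ h2]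
  · rw [LL_apply, RR_apply, RR_apply, RR_apply, LL_apply, LL_apply]
    simp only [left_asc_mul_tau N w i j h, right_asc_tau_mul N w i j h, mul_assoc]
    split_ifs <;> ring

/-- delta at the identity -/
def dl : FF k N := Pi.single 1 1

lemma L_dl (i : Fin N) : LL k N i (dl k N) = RR k N i (dl k N) := by
  ext w
  rw [LL_apply, RR_apply]
  by_cases h : tau N i * w = w * tau N i
  · rw [h]; simp only [asc_eq N w i i h]
  · have h1 : w ≠ 1 := by rintro rfl; simp at h
    have h2 : w ≠ tau N i := by rintro rfl; exact h rfl
    have h3 : tau N i * w ≠ 1 := by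
      intro h4; apply h2; rw [← tau_inv]; exact (inv_eq_of_mul_eq_one_right h4).symm
    have h4 : w * tau N i ≠ 1 := by
      intro h4; apply h2; rw [← tau_inv]; exact (inv_eq_of_mul_eq_one_left h4).symm
    simp [dl, Pi.single_apply, h1, h3, h4]

lemma dist_empty (w : Equiv.Perm (Fin (N+1))) : IsDistL N ∅ w := by
  rw [dist_iff]; simp

lemma GG_empty (m : IndM k N (∅ : Set (Fin N))) (w) :
    GG k N ∅ m w = cf k N ∅ (Dset.mkD (w) (dist_empty N w)) m := by
  rw [GG_apply, rep_eq N ∅ (σ := (Dset.mkD (w) (dist_empty N w)))]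
  simp [one_mem]

/-- the regular module is functions -/
def EE : IndM k N (∅ : Set (Fin N)) ≃ₗ[k] FF k N :=
  LinearEquiv.ofBijective (GG k N ∅) ⟨GG_inj k N ∅, fun f => ⟨ofC k N ∅ fun σ => f σ.dv, by
    ext w; rw [GG_empty, cf_ofC, Dset.dv_mkD]⟩⟩

lemma EE_apply (m) : EE k N m = GG k N ∅ m := rfl

lemma GG_one (B : Set (Fin N)) (w) : GG k N B (bv k N B (oneDist N B)) w =
    if w ∈ youngSubgroup N B then 1 else 0 := by
  rw [GG_apply, cf_bv]
  congr 1
  apply propext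
  constructor
  · intro h
    have := rep_mem N B w
    rw [← h] at this
    simpa using this
  · intro h
    symm
    apply rep_eq
    simpa using h

lemma GG_dl : GG k N ∅ (bv k N ∅ (oneDist N ∅)) = dl k N := by
  ext w
  rw [GG_one]
  simp [dl, Pi.single_apply, youngSubgroup]

lemma genF (S : Submodule k (FF k N)) (h1 : dl k N ∈ S) (hT : ∀ i, ∀ m ∈ S, LL k N i m ∈ S) :
    S = ⊤ := by
  have := gen k N ∅ (S.comap (GG k N ∅)) (by rw [Submodule.mem_comap, GG_dl]; exact h1)
    (fun i m hm => by rw [Submodule.mem_comap, GG_TT]; exact hT i _ hm)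
  rw [eq_top_iff]
  intro f _
  obtain ⟨m, rfl⟩ := (EE k N).surjective f
  have h2 : m ∈ S.comap (GG k N ∅) := by rw [this]; trivial
  exact h2

lemma exists_H (y : FF k N) : ∃ H : Module.End k (FF k N),
    (∀ i f, H (LL k N i f) = LL k N i (H f)) ∧ H (dl k N) = y := by
  let S : Submodule k (FF k N) :=
    { carrier := {y | ∃ H : Module.End k (FF k N),
        (∀ i f, H (LL k N i f) = LL k N i (H f)) ∧ H (dl k N) = y}
      add_mem' := by
        rintro _ _ ⟨H, h1, rfl⟩ ⟨H', h1', rfl⟩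
        exact ⟨H + H', fun i f => by simp [h1, h1'], rfl⟩
      zero_mem' := ⟨0, fun i f => by simp, rfl⟩
      smul_mem' := by
        rintro c _ ⟨H, h1, rfl⟩
        exact ⟨c • H, fun i f => by simp [h1], rfl⟩ }
  have : S = ⊤ := by
    apply genF
    · exact ⟨1, fun i f => rfl, rfl⟩
    · rintro i _ ⟨H, h1, rfl⟩
      refine ⟨H ∘ₗ RR k N i, fun j f => ?_, ?_⟩
      · simp only [LinearMap.comp_apply]
        rw [← LR_comm, h1]
      · simp only [LinearMap.comp_apply]
        rw [← L_dl, h1]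
  have h2 : y ∈ S := by rw [this]; trivial
  exact h2

/-- universal property of the regular module -/
lemma exists_h (B : Set (Fin N)) (m : IndM k N B) :
    ∃ h : IndM k N (∅ : Set (Fin N)) →ₗ[k] IndM k N B,
      (∀ i v, h (TT k N ∅ i v) = TT k N B i (h v)) ∧ h (bv k N ∅ (oneDist N ∅)) = m := by
  obtain ⟨H, h1, h2⟩ := exists_H k N (GG k N B m)
  have h3 : (LinearMap.range (GG k N B)).comap H = ⊤ := by
    apply genF
    · rw [Submodule.mem_comap, h2]; exact ⟨m, rfl⟩
    · rintro i f hf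
      rw [Submodule.mem_comap] at hf ⊢
      obtain ⟨v, hv⟩ := hf
      exact ⟨TT k N B i v, by rw [GG_TT, h1, hv]⟩
  have h4 : ∀ f, H f ∈ LinearMap.range (GG k N B) := fun f => by
    have : f ∈ (LinearMap.range (GG k N B)).comap H := by rw [h3]; trivial
    exact this
  let h' : FF k N →ₗ[k] IndM k N B :=
    ((LinearEquiv.ofInjective (GG k N B) (GG_inj k N B)).symm : _ →ₗ[k] _) ∘ₗ H.codRestrict _ h4
  have h5 : ∀ f, GG k N B (h' f) = H f := by
    intro f
    have := LinearEquiv.apply_symm_apply (LinearEquiv.ofInjective (GG k N B) (GG_inj k N B))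
      (H.codRestrict _ h4 f)
    exact congrArg Subtype.val this
  refine ⟨h' ∘ₗ GG k N ∅, fun i v => ?_, ?_⟩
  · apply GG_inj
    simp only [LinearMap.comp_apply]
    rw [h5, GG_TT, GG_TT, h5, h1]
  · apply GG_inj
    simp only [LinearMap.comp_apply]
    rw [h5, GG_dl, h2]

/-- the operator `x_μ` -/
abbrev xop {M : Type} [AddCommGroup M] [Module k M] (T : Fin N → Module.End k M)
    (Bm : Set (Fin N)) : Module.End k M :=
  ∑ σ : Equiv.Perm (Fin (N + 1)), if σ ∈ youngSubgroup N Bm then Tperm k N T σ else 0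

lemma Tperm_comm {M M' : Type} [AddCommGroup M] [Module k M] [AddCommGroup M'] [Module k M']
    (T : Fin N → Module.End k M) (T' : Fin N → Module.End k M') (f : M →ₗ[k] M')
    (hf : ∀ i v, f (T i v) = T' i (f v)) (σ) (v : M) :
    f (Tperm k N T σ v) = Tperm k N T' σ (f v) := by
  unfold Tperm
  split_ifs with h
  · generalize h.choose = l
    induction l with
    | nil => simp
    | cons i l ih => simp [hf, ih]
  · simp

lemma xop_comm {M M' : Type} [AddCommGroup M] [Module k M] [AddCommGroup M'] [Module k M']
    (T : Fin N → Module.End k M) (T' : Fin N → Module.End k M') (f : M →ₗ[k] M')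
    (hf : ∀ i v, f (T i v) = T' i (f v)) (Bm : Set (Fin N)) (v : M) :
    f (xop k N T Bm v) = xop k N T' Bm (f v) := by
  simp only [LinearMap.sum_apply, map_sum]
  apply Finset.sum_congr rfl
  intro σ _
  split_ifs
  · exact Tperm_comm k N T T' f hf σ v
  · simp

lemma word_act (B Bm : Set (Fin N)) (d : Dset N B)
    (hd : ∀ i ∈ Bm, (d.dv)⁻¹ i.castSucc < (d.dv)⁻¹ i.succ)
    (hall : ∀ s ∈ youngSubgroup N Bm, IsDistL N B (s * d.dv)) (l : List (Fin N)) :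
    ∀ (s) (hs : s ∈ youngSubgroup N Bm), (l.map (tau N)).prod = s → l.length = len N s →
      (l.map (TT k N B)).prod (bv k N B d) = bv k N B (Dset.mkD (s * d.dv) (hall s hs)) := by
  induction l with
  | nil =>
    intro s hs h1 _
    simp only [List.map_nil, List.prod_nil] at h1 ⊢
    subst h1
    rw [Module.End.one_apply]
    exact congrArg (bv k N B) (Dset.dext (one_mul _).symm)
  | cons i l ih =>
    intro s hs h1 h2
    simp only [List.map_cons, List.prod_cons, List.length_cons] at h1 h2 ⊢
    set s' := (l.map (tau N)).prod with hs'
    have h3 : len N s' ≤ l.length := Nat.sInf_le ⟨l, rfl, rfl⟩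
    have h4 : s'⁻¹ i.castSucc < s'⁻¹ i.succ := by
      rw [← len_lt_iff, h1]; omega
    have h5 := len_tau_mul_asc N s' i h4
    rw [h1] at h5
    have hi : i ∈ Bm := by
      by_contra hi
      have hs2 := inv_mem hs
      have e1 := (SB_young N Bm hs2 i.castSucc i hi).1 le_rfl
      have e2 := (SB_young N Bm hs2 i.succ i hi).not.1 (not_le.mpr Fin.castSucc_lt_succ)
      rw [← h1, mul_inv_rev, tau_inv, Equiv.Perm.mul_apply, tau_castSucc] at e1
      rw [← h1, mul_inv_rev, tau_inv, Equiv.Perm.mul_apply, tau_succ] at e2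
      exact e2 (h4.le.trans e1)
    have hs'm : s' ∈ youngSubgroup N Bm := by
      have := mul_mem (tau_mem N Bm hi) hs
      rwa [← h1, tau_mul_cancel] at this
    rw [Module.End.mul_apply, ih s' hs'm rfl (by omega), TT_mk]
    have e : tau N i * (s' * d.dv) = s * d.dv := by rw [← mul_assoc, h1]
    rw [dif_pos (show IsDistL N B (tau N i * (s' * d.dv)) by rw [e]; exact hall s hs), if_pos]
    · congr 1
      exact Dset.dext e
    · simp only [mul_inv_rev, Equiv.Perm.mul_apply]
      apply lt_of_SB N Bm _ hd h4
      have hs2 := inv_mem hs'm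
      exact SB_trans N Bm (SB_symm N Bm (SB_young N Bm hs2 _))
        (SB_trans N Bm (SB_self N Bm hi) (SB_young N Bm hs2 _))

lemma Tperm_bv (B Bm : Set (Fin N)) (d : Dset N B)
    (hd : ∀ i ∈ Bm, (d.dv)⁻¹ i.castSucc < (d.dv)⁻¹ i.succ)
    (hall : ∀ s ∈ youngSubgroup N Bm, IsDistL N B (s * d.dv)) (s)
    (hs : s ∈ youngSubgroup N Bm) :
    Tperm k N (TT k N B) s (bv k N B d) = bv k N B (Dset.mkD (s * d.dv) (hall s hs)) := by
  have h : ∃ l : List (Fin N), (l.map (tau N)).prod = s ∧ l.length = len N s := by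
    obtain ⟨l, h1, h2⟩ := exists_word N _ s rfl
    exact ⟨l, h2, by rw [len_eq, h1]⟩
  unfold Tperm
  rw [dif_pos h]
  exact word_act k N B Bm d hd hall _ s hs h.choose_spec.1 h.choose_spec.2

lemma xop_bv (B Bm : Set (Fin N)) (d : Dset N B)
    (hd : ∀ i ∈ Bm, (d.dv)⁻¹ i.castSucc < (d.dv)⁻¹ i.succ)
    (hall : ∀ s ∈ youngSubgroup N Bm, IsDistL N B (s * d.dv)) (w : Dset N B) :
    cf k N B w (xop k N (TT k N B) Bm (bv k N B d)) =
      if w.dv * (d.dv)⁻¹ ∈ youngSubgroup N Bm then 1 else 0 := by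
  simp only [LinearMap.sum_apply, map_sum]
  have e : ∀ s, cf k N B w ((if s ∈ youngSubgroup N Bm then Tperm k N (TT k N B) s else 0)
      (bv k N B d)) = if s = w.dv * (d.dv)⁻¹ then
        (if w.dv * (d.dv)⁻¹ ∈ youngSubgroup N Bm then 1 else 0) else 0 := by
    intro s
    by_cases hs : s ∈ youngSubgroup N Bm
    · rw [if_pos hs, Tperm_bv k N B Bm d hd hall s hs, cf_bv]
      by_cases h2 : s = w.dv * (d.dv)⁻¹
      · have h3 : Dset.mkD (s * d.dv) (hall s hs) = w := Dset.dext (by simp [h2])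
        rw [if_pos h3, if_pos h2, if_pos (h2 ▸ hs)]
      · rw [if_neg h2, if_neg]
        intro h3
        apply h2
        rw [← congrArg Dset.dv h3]
        simp
    · rw [if_neg hs, LinearMap.zero_apply, map_zero]
      split_ifs with h1 h2
      · rw [← h1] at h2; exact absurd h2 hs
      · rfl
      · rfl
  rw [Finset.sum_congr rfl (fun s _ => e s)]
  simp

/-- (c) implies (b) -/
lemma c_imp_b (B Bm : Set (Fin N)) (m : IndM k N B)
    (hm : ∀ i ∈ Bm, m ∈ LinearMap.range (TT k N B i + 1)) :
    m ∈ LinearMap.range (xop k N (TT k N B) Bm) := by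
  let a : FF k N := fun w => if h : IsDistL N B w then cf k N B (Dset.mkD (w) (h)) m else 0
  have ha : ∀ σ : Dset N B, a σ.dv = cf k N B σ m := fun σ => dif_pos σ.dd
  have ha' : ∀ w, a w ≠ 0 → IsDistL N B w := fun w h => by
    by_contra hc; exact h (dif_neg hc)
  have half : ∀ i ∈ Bm, ∀ w, IsDistL N B w → a (tau N i * w) = a w := by
    intro i hi w hw
    obtain ⟨y, hy⟩ := hm i hi
    have e : ∀ σ : Dset N B, cf k N B σ m = cf k N B σ (TT k N B i y) + cf k N B σ y := by
      intro σ; rw [← hy]; simp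
    by_cases hD : IsDistL N B (tau N i * w)
    · have hD2 : IsDistL N B (tau N i * (tau N i * w)) := by rw [tau_mul_cancel]; exact hw
      have hs : ((Dset.mkD (tau N i * (tau N i * w)) (hD2)) : Dset N B) = (Dset.mkD (w) (hw)) :=
        Dset.dext (tau_mul_cancel N i w)
      have e1 := e (Dset.mkD (w) (hw))
      have e2 := e (Dset.mkD (_) (hD))
      rw [TT_cf_mk, dif_pos hD] at e1
      rw [TT_cf_mk, dif_pos hD2, hs] at e2
      simp only [left_asc_tau] at e1 e2
      rw [show a (tau N i * w) = _ from ha (Dset.mkD _ hD), show a w = _ from ha (Dset.mkD w hw), e1, e2]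
      split_ifs <;> ring
    · have e1 := e (Dset.mkD (w) (hw))
      rw [TT_cf_mk, dif_neg hD] at e1
      rw [show a w = _ from ha (Dset.mkD w hw), e1]
      simp [a, hD]
  have full : ∀ i ∈ Bm, ∀ w, a (tau N i * w) = a w := by
    intro i hi w
    by_cases hw : IsDistL N B w
    · exact half i hi w hw
    · by_cases hD : IsDistL N B (tau N i * w)
      · have := half i hi _ hD
        rw [tau_mul_cancel] at this
        exact this.symm
      · simp [a, hw, hD]
  have inv : ∀ s ∈ youngSubgroup N Bm, ∀ w, a (s * w) = a w := by
    intro s hs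
    induction hs using Subgroup.closure_induction with
    | mem y hy =>
      obtain ⟨j, hj, rfl⟩ := hy
      exact full j hj
    | one => intro w; rw [one_mul]
    | mul x y _ _ hx hy => intro w; rw [mul_assoc, hx, hy]
    | inv x _ hx => intro w; rw [← hx (x⁻¹ * w), mul_inv_cancel_left]
  let := Fintype.ofFinite (Dset N B)
  refine ⟨∑ d : Dset N B, (if IsDistL N Bm (d.dv)⁻¹ then a d.dv else 0) • bv k N B d, ?_⟩
  apply cf_ext
  intro w
  rw [map_sum, map_sum]
  have e : ∀ d : Dset N B, cf k N B w (xop k N (TT k N B) Bm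
      ((if IsDistL N Bm (d.dv)⁻¹ then a d.dv else 0) • bv k N B d)) =
      if IsDistL N Bm (d.dv)⁻¹ ∧ w.dv * (d.dv)⁻¹ ∈ youngSubgroup N Bm then a w.dv else 0 := by
    intro d
    rw [map_smul, map_smul]
    by_cases h1 : IsDistL N Bm (d.dv)⁻¹
    · by_cases h0 : a d.dv = 0
      · rw [if_pos h1, h0, zero_smul]
        split_ifs with h2
        · have := inv _ h2.2 d.dv
          rw [inv_mul_cancel_right, h0] at this
          exact this.symm
        · rfl
      · rw [xop_bv k N B Bm d (asc_of_dist N Bm h1)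
          (fun s hs => ha' _ (by rw [inv s hs]; exact h0))]
        by_cases h2 : w.dv * (d.dv)⁻¹ ∈ youngSubgroup N Bm
        · have := inv _ h2 d.dv
          rw [inv_mul_cancel_right] at this
          simp [h1, h2, this]
        · simp [h2]
    · simp [h1]
  rw [Finset.sum_congr rfl (fun d _ => e d), ← ha w]
  by_cases h0 : a w.dv = 0
  · simp [h0]
  · have hr := rep_mem N Bm (w.dv)⁻¹
    rw [inv_inv] at hr
    have hu : a ((rep N Bm (w.dv)⁻¹).dv)⁻¹ = a w.dv := by
      rw [← inv _ hr, mul_assoc, mul_inv_cancel, mul_one]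
    have hD : IsDistL N B ((rep N Bm (w.dv)⁻¹).dv)⁻¹ := ha' _ (by rw [hu]; exact h0)
    rw [Finset.sum_eq_single ((Dset.mkD (_) (hD)) : Dset N B)]
    · rw [if_pos]
      refine ⟨?_, ?_⟩
      · simpa only [Dset.dv_mkD, inv_inv] using (rep N Bm (w.dv)⁻¹).dd
      · simpa only [Dset.dv_mkD, inv_inv] using hr
    · intro d _ hne
      rw [if_neg]
      rintro ⟨h1, h2⟩
      apply hne
      apply Dset.dext
      have := rep_eq N Bm (w := (w.dv)⁻¹) (σ := (Dset.mkD (_) (h1))) (by simpa only [Dset.dv_mkD, inv_inv] using h2)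
      simp only [this, Dset.dv_mkD, inv_inv]
    · intro h; exact absurd (Finset.mem_univ _) h

lemma TT_one (B : Set (Fin N)) {i : Fin N} (hi : i ∈ B) :
    TT k N B i (bv k N B (oneDist N B)) = - bv k N B (oneDist N B) := by
  rw [TT_bv, dif_neg]
  have := not_dist_mul N B (oneDist N B).dd hi
  simpa using this

/-- in the regular module the `-1` eigenspace is the image of `T_i+1` -/
lemma reg_ker (i : Fin N) (y : IndM k N (∅ : Set (Fin N))) (h : TT k N ∅ i y = - y) :
    y ∈ LinearMap.range (TT k N ∅ i + 1) := by
  refine ⟨ofC k N ∅ fun w => if (w.dv)⁻¹ i.castSucc < (w.dv)⁻¹ i.succ then cf k N ∅ w y else 0, ?_⟩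
  apply cf_ext
  intro w
  have h1 := congrArg (cf k N ∅ w) h
  rw [map_neg, TT_cf, dif_pos (dist_empty N _)] at h1
  rw [LinearMap.add_apply, map_add, TT_cf, dif_pos (dist_empty N _), Module.End.one_apply]
  simp only [cf_ofC, Dset.dv_mkD, left_asc_tau]
  by_cases ha : (w.dv)⁻¹ i.castSucc < (w.dv)⁻¹ i.succ
  · simp only [ha, if_true, not_true, if_false, neg_zero, zero_add]
  · rw [if_neg ha] at h1
    simp only [ha, if_false, not_false_iff, if_true]
    linear_combination h1

end helpers

/-- for `q = -1` and modules `M = H_n(-1) ⊗_{H_λ} k`,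
`N' = H_n(-1) ⊗_{H_μ} k` induced from the (unique) one-dimensional
representations of two parabolic subalgebras (every `T_i` acting by `-1`),
with canonical generators `c`, `c'`, the following are equivalent for a module
homomorphism `φ : N' → M`:
(a) `φ` factors through a free `H_n(-1)`-module (a finite direct sum of copies
of the regular module, i.e. of the module induced from the empty parabolic);
(b) `φ(c') ∈ x_μ M` where `x_μ = Σ_{σ ∈ S_μ} T_σ`;
(c) `φ(c') ∈ (T_i + 1) M` for each `i` with `τ_i ∈ B_μ`. -/
theorem factor_through_free_iff (Bl Bm : Set (Fin N))
    (φ : IndM k N Bm →ₗ[k] IndM k N Bl)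
    (hφ : ∀ i : Fin N,
      φ ∘ₗ indT k N (-1) Bm (fun _ => -1) i =
        (indT k N (-1) Bl (fun _ => -1) i : Module.End k (IndM k N Bl)) ∘ₗ φ) :
    ((∃ (r : ℕ) (g : IndM k N Bm →ₗ[k] (Fin r → IndM k N (∅ : Set (Fin N))))
        (h : (Fin r → IndM k N (∅ : Set (Fin N))) →ₗ[k] IndM k N Bl),
        (∀ i : Fin N, g ∘ₗ indT k N (-1) Bm (fun _ => -1) i =
          (indT k N (-1) (∅ : Set (Fin N)) (fun _ => -1) i).compLeft (Fin r) ∘ₗ g) ∧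
        (∀ i : Fin N, h ∘ₗ (indT k N (-1) (∅ : Set (Fin N)) (fun _ => -1) i).compLeft (Fin r) =
          (indT k N (-1) Bl (fun _ => -1) i : Module.End k (IndM k N Bl)) ∘ₗ h) ∧
        φ = h ∘ₗ g) ↔
      φ (Finsupp.single (oneDist N Bm) 1) ∈
        LinearMap.range (∑ σ : Equiv.Perm (Fin (N + 1)),
          if σ ∈ youngSubgroup N Bm then
            Tperm k N (indT k N (-1) Bl (fun _ => -1)) σ else 0)) ∧
    (φ (Finsupp.single (oneDist N Bm) 1) ∈
        LinearMap.range (∑ σ : Equiv.Perm (Fin (N + 1)),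
          if σ ∈ youngSubgroup N Bm then
            Tperm k N (indT k N (-1) Bl (fun _ => -1)) σ else 0) ↔
      ∀ i ∈ Bm, φ (Finsupp.single (oneDist N Bm) 1) ∈
        LinearMap.range ((indT k N (-1) Bl (fun _ => -1) i : Module.End k (IndM k N Bl)) + 1)) := by
  have hφ' : ∀ i v, φ (TT k N Bm i v) = TT k N Bl i (φ v) :=
    fun i v => LinearMap.congr_fun (hφ i) v
  have hca : (∃ (r : ℕ) (g : IndM k N Bm →ₗ[k] (Fin r → IndM k N (∅ : Set (Fin N))))
        (h : (Fin r → IndM k N (∅ : Set (Fin N))) →ₗ[k] IndM k N Bl),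
        (∀ i : Fin N, g ∘ₗ indT k N (-1) Bm (fun _ => -1) i =
          (indT k N (-1) (∅ : Set (Fin N)) (fun _ => -1) i).compLeft (Fin r) ∘ₗ g) ∧
        (∀ i : Fin N, h ∘ₗ (indT k N (-1) (∅ : Set (Fin N)) (fun _ => -1) i).compLeft (Fin r) =
          (indT k N (-1) Bl (fun _ => -1) i : Module.End k (IndM k N Bl)) ∘ₗ h) ∧
        φ = h ∘ₗ g) → ∀ i ∈ Bm, φ (bv k N Bm (oneDist N Bm)) ∈
          LinearMap.range (TT k N Bl i + 1) := by
    rintro ⟨r, g, h, hg, hh, rfl⟩ i hi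
    have h1 : ∀ t, TT k N ∅ i (g (bv k N Bm (oneDist N Bm)) t) =
        - g (bv k N Bm (oneDist N Bm)) t := by
      intro t
      have h2 := congrFun (LinearMap.congr_fun (hg i) (bv k N Bm (oneDist N Bm))) t
      have h3 : g (TT k N Bm i (bv k N Bm (oneDist N Bm))) t =
        TT k N ∅ i (g (bv k N Bm (oneDist N Bm)) t) := h2
      rw [← h3, TT_one k N Bm hi, map_neg]
      rfl
    choose z hz using fun t => reg_ker k N i _ (h1 t)
    refine ⟨h z, ?_⟩
    have h4 : h ((TT k N ∅ i).compLeft (Fin r) z) = TT k N Bl i (h z) :=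
      LinearMap.congr_fun (hh i) z
    rw [LinearMap.add_apply, Module.End.one_apply, ← h4, ← map_add, LinearMap.comp_apply]
    congr 1
    funext t
    exact hz t
  have hba : φ (bv k N Bm (oneDist N Bm)) ∈ LinearMap.range (xop k N (TT k N Bl) Bm) →
      (∃ (r : ℕ) (g : IndM k N Bm →ₗ[k] (Fin r → IndM k N (∅ : Set (Fin N))))
        (h : (Fin r → IndM k N (∅ : Set (Fin N))) →ₗ[k] IndM k N Bl),
        (∀ i : Fin N, g ∘ₗ indT k N (-1) Bm (fun _ => -1) i =
          (indT k N (-1) (∅ : Set (Fin N)) (fun _ => -1) i).compLeft (Fin r) ∘ₗ g) ∧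
        (∀ i : Fin N, h ∘ₗ (indT k N (-1) (∅ : Set (Fin N)) (fun _ => -1) i).compLeft (Fin r) =
          (indT k N (-1) Bl (fun _ => -1) i : Module.End k (IndM k N Bl)) ∘ₗ h) ∧
        φ = h ∘ₗ g) := by
    rintro ⟨m, hm⟩
    obtain ⟨h0, hT, hone⟩ := exists_h k N Bl m
    let g0 : IndM k N Bm →ₗ[k] IndM k N (∅ : Set (Fin N)) :=
      ((EE k N).symm : FF k N →ₗ[k] IndM k N (∅ : Set (Fin N))) ∘ₗ GG k N Bm
    have hg0 : ∀ v, GG k N ∅ (g0 v) = GG k N Bm v := fun v =>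
      (EE k N).apply_symm_apply (GG k N Bm v)
    have hg1 : ∀ i v, g0 (TT k N Bm i v) = TT k N ∅ i (g0 v) := by
      intro i v
      apply GG_inj
      rw [hg0, GG_TT, GG_TT, hg0]
    have hg2 : g0 (bv k N Bm (oneDist N Bm)) =
        xop k N (TT k N ∅) Bm (bv k N ∅ (oneDist N ∅)) := by
      apply GG_inj
      funext w
      rw [hg0, GG_one, GG_empty, xop_bv k N ∅ Bm (oneDist N ∅)
        (fun i _ => by rw [Dset.dv_one, inv_one]; exact Fin.castSucc_lt_succ)
        (fun s _ => dist_empty N _)]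
      simp only [Dset.dv_mkD, Dset.dv_one, inv_one, mul_one]
    refine ⟨1, LinearMap.pi fun _ => g0, h0 ∘ₗ LinearMap.proj 0, fun i => ?_, fun i => ?_, ?_⟩
    · apply LinearMap.ext
      intro v
      funext t
      exact hg1 i v
    · apply LinearMap.ext
      intro v
      exact hT i (v 0)
    · have htop := gen k N Bm (LinearMap.eqLocus φ (h0 ∘ₗ g0)) (by
          rw [LinearMap.mem_eqLocus, LinearMap.comp_apply, hg2,
            xop_comm k N (TT k N ∅) (TT k N Bl) h0 hT, hone, hm]) (by
          intro i v hv
          rw [LinearMap.mem_eqLocus, LinearMap.comp_apply] at hv ⊢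
          rw [hφ', hv, hg1, hT])
      apply LinearMap.ext
      intro v
      have hv : v ∈ LinearMap.eqLocus φ (h0 ∘ₗ g0) := by rw [htop]; trivial
      exact hv
  have hcb := c_imp_b k N Bl Bm (φ (bv k N Bm (oneDist N Bm)))
  exact ⟨⟨fun h => hcb (hca h), hba⟩, ⟨fun h => hca (hba h), hcb⟩⟩

end
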